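/- arXiv:1703.08149 — 5 statements merged into one kernel-verified Lean document; each statement's English description precedes it below -/
import Mathlib

section
/- For every ρ > 0, (2/(√π (2π)^{5/2})) ∫_ρ^∞ (1/√(cosh r − cosh ρ)) · (1/(r² sinh r) + cosh r/(r sinh² r)) dr ≤ (8/(√π (2π)^{5/2})) · 1/(ρ √(cosh ρ + 1) (cosh ρ − 1)). -/
open MeasureTheory Real

noncomputable section

/-- The kernel of `(-Δ_ℍ - 9/4)^{-1/2}` on 4-dimensional hyperbolic space, as a
function of the geodesic distance `ρ`. -/
def Ghalf (ρ : ℝ) : ℝ :=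
  (2 / (Real.sqrt π * (2 * π) ^ ((5 : ℝ) / 2))) *
    ∫ r in Set.Ioi ρ,
      (1 / Real.sqrt (Real.cosh r - Real.cosh ρ)) *
        (1 / (r ^ 2 * Real.sinh r) + Real.cosh r / (r * Real.sinh r ^ 2))

end

open Set Filter Topology

/-- The inequality `tanh r ≤ r` for `r ≥ 0`, in product form. -/
theorem sinh_le_self_mul_cosh {r : ℝ} (hr : 0 ≤ r) : Real.sinh r ≤ r * Real.cosh r := by
  have hd : ∀ x : ℝ, HasDerivAt (fun x => x * Real.cosh x - Real.sinh x) (x * Real.sinh x) x := by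
    intro x
    have h := ((hasDerivAt_id' x).mul (Real.hasDerivAt_cosh x)).sub (Real.hasDerivAt_sinh x)
    exact h.congr_deriv (by ring)
  have hmono : MonotoneOn (fun x => x * Real.cosh x - Real.sinh x) (Ici 0) := by
    refine monotoneOn_of_deriv_nonneg (convex_Ici 0)
      (fun x _ => (hd x).continuousAt.continuousWithinAt)
      (fun x _ => (hd x).differentiableAt.differentiableWithinAt) fun x hx => ?_
    rw [interior_Ici] at hx
    rw [(hd x).deriv]
    exact mul_nonneg (le_of_lt hx) (Real.sinh_nonneg_iff.2 (le_of_lt hx))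
  have h := hmono self_mem_Ici hr hr
  simp only [zero_mul, Real.sinh_zero, sub_zero] at h
  linarith

theorem tendsto_cosh_atTop_atTop : Tendsto Real.cosh atTop atTop := by
  refine tendsto_atTop_mono' atTop ?_ tendsto_id
  filter_upwards [eventually_ge_atTop (0 : ℝ)] with x hx
  exact (Real.self_le_sinh_iff.2 hx).trans (Real.sinh_lt_cosh x).le

theorem hasDerivAt_sqrt_cosh_ratio {ρ r : ℝ} (hρ : 0 < ρ) (hr : ρ < r) :
    HasDerivAt
      (fun r => √((Real.cosh r - Real.cosh ρ) / (Real.cosh r - 1)))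
      ((Real.cosh ρ - 1) * Real.sinh r /
        (2 * √(Real.cosh r - Real.cosh ρ) * (√(Real.cosh r - 1) * (Real.cosh r - 1)))) r := by
  have h1 : 0 < Real.cosh r - 1 := sub_pos.2 (Real.one_lt_cosh.2 (by linarith))
  have hc : 0 < Real.cosh r - Real.cosh ρ :=
    sub_pos.2 (Real.cosh_strictMonoOn hρ.le (hρ.trans hr).le hr)
  have h := (((Real.hasDerivAt_cosh r).sub_const (Real.cosh ρ)).div
    ((Real.hasDerivAt_cosh r).sub_const 1) h1.ne').sqrt (div_pos hc h1).ne'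
  refine HasDerivAt.congr_deriv h ?_
  rw [Pi.div_apply, Real.sqrt_div hc.le]
  have hs : 0 < √(Real.cosh r - 1) := Real.sqrt_pos.2 h1
  have ht : 0 < √(Real.cosh r - Real.cosh ρ) := Real.sqrt_pos.2 hc
  have hs2 : √(Real.cosh r - 1) ^ 2 = Real.cosh r - 1 := Real.sq_sqrt h1.le
  field_simp
  rw [hs2]
  ring

theorem tendsto_sqrt_cosh_ratio (c : ℝ) :
    Tendsto (fun r => √((Real.cosh r - c) / (Real.cosh r - 1))) atTop (𝓝 1) := by
  have h : Tendsto (fun r => 1 - (c - 1) / (Real.cosh r - 1)) atTop (𝓝 (1 - 0)) :=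
    tendsto_const_nhds.sub (tendsto_const_nhds.div_atTop
      (tendsto_atTop_add_const_right _ (-1) tendsto_cosh_atTop_atTop))
  have h' := h.sqrt
  rw [sub_zero, Real.sqrt_one] at h'
  refine h'.congr' ?_
  filter_upwards [eventually_gt_atTop (0 : ℝ)] with r hr
  have h1 : 0 < Real.cosh r - 1 := sub_pos.2 (Real.one_lt_cosh.2 hr.ne')
  congr 1
  field_simp
  ring

theorem Ghalf_integrand_le {ρ r : ℝ} (hρ : 0 < ρ) (hr : ρ < r) :
    (1 / √(Real.cosh r - Real.cosh ρ)) *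
        (1 / (r ^ 2 * Real.sinh r) + Real.cosh r / (r * Real.sinh r ^ 2)) ≤
      4 * (1 / (ρ * √(Real.cosh ρ + 1) * (Real.cosh ρ - 1))) *
      ((Real.cosh ρ - 1) * Real.sinh r /
        (2 * √(Real.cosh r - Real.cosh ρ) * (√(Real.cosh r - 1) * (Real.cosh r - 1)))) := by
  have hr0 : 0 < r := hρ.trans hr
  have hS : 0 < Real.sinh r := Real.sinh_pos_iff.2 hr0
  have hC : 0 < Real.cosh r := Real.cosh_pos r
  have hρ1 : 0 < Real.cosh ρ - 1 := sub_pos.2 (Real.one_lt_cosh.2 hρ.ne')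
  have h1 : 0 < Real.cosh r - 1 := sub_pos.2 (Real.one_lt_cosh.2 hr0.ne')
  have hc : 0 < Real.cosh r - Real.cosh ρ :=
    sub_pos.2 (Real.cosh_strictMonoOn hρ.le hr0.le hr)
  have ht : 0 < √(Real.cosh r - Real.cosh ρ) := Real.sqrt_pos.2 hc
  have ha : 0 < √(Real.cosh r - 1) := Real.sqrt_pos.2 h1
  have hd : 0 < √(Real.cosh ρ + 1) := Real.sqrt_pos.2 (by linarith)
  have hb : 0 < √(Real.cosh r + 1) := Real.sqrt_pos.2 (by linarith)
  have ha2 : √(Real.cosh r - 1) ^ 2 = Real.cosh r - 1 := Real.sq_sqrt h1.le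
  have hb2 : √(Real.cosh r + 1) ^ 2 = Real.cosh r + 1 := Real.sq_sqrt (by linarith)
  have hdb : √(Real.cosh ρ + 1) ≤ √(Real.cosh r + 1) := Real.sqrt_le_sqrt (by linarith)
  have hSab : Real.sinh r = √(Real.cosh r - 1) * √(Real.cosh r + 1) := by
    rw [← Real.sqrt_mul h1.le, eq_comm, Real.sqrt_eq_iff_mul_self_eq (by nlinarith) hS.le]
    nlinarith [Real.cosh_sq r]
  have hsum : 1 / (r ^ 2 * Real.sinh r) + Real.cosh r / (r * Real.sinh r ^ 2) ≤
      2 / ρ * (Real.cosh r / Real.sinh r ^ 2) := by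
    have e1 : 1 / (r ^ 2 * Real.sinh r) ≤ Real.cosh r / (r * Real.sinh r ^ 2) := by
      rw [div_le_div_iff₀ (by positivity) (by positivity)]
      nlinarith [mul_le_mul_of_nonneg_left (sinh_le_self_mul_cosh hr0.le)
        (mul_pos hr0 hS).le]
    have e2 : Real.cosh r / (r * Real.sinh r ^ 2) ≤ Real.cosh r / (ρ * Real.sinh r ^ 2) := by
      gcongr
    calc _ ≤ 2 * (Real.cosh r / (ρ * Real.sinh r ^ 2)) := by linarith
      _ = _ := by field_simp
  have hmain : Real.cosh r / Real.sinh r ^ 2 ≤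
      Real.sinh r / (√(Real.cosh ρ + 1) * (√(Real.cosh r - 1) * (Real.cosh r - 1))) := by
    have hCd : Real.cosh r * √(Real.cosh ρ + 1) ≤ √(Real.cosh r + 1) ^ 3 := by
      rw [pow_succ, hb2]
      gcongr
      linarith
    rw [div_le_div_iff₀ (by positivity) (by positivity), hSab]
    have h := mul_le_mul_of_nonneg_left hCd (pow_pos ha 3).le
    calc _ = √(Real.cosh r - 1) * √(Real.cosh r - 1) ^ 2 *
          (Real.cosh r * √(Real.cosh ρ + 1)) := by rw [ha2]; ring
      _ ≤ _ := by linarith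
  calc _ ≤ 1 / √(Real.cosh r - Real.cosh ρ) * (2 / ρ *
        (Real.sinh r / (√(Real.cosh ρ + 1) * (√(Real.cosh r - 1) * (Real.cosh r - 1))))) := by
        gcongr
        exact hsum.trans (by gcongr)
    _ = _ := by
        field_simp
        norm_num

theorem Ghalf_estimate_two (ρ : ℝ) (hρ : 0 < ρ) :
    Ghalf ρ ≤ (8 / (Real.sqrt π * (2 * π) ^ ((5 : ℝ) / 2))) *
      (1 / (ρ * Real.sqrt (Real.cosh ρ + 1) * (Real.cosh ρ - 1))) := by
  have hρ1 : 0 < Real.cosh ρ - 1 := sub_pos.2 (Real.one_lt_cosh.2 hρ.ne')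
  set K := 1 / (ρ * √(Real.cosh ρ + 1) * (Real.cosh ρ - 1))
  have hK0 : 0 ≤ K := by
    have := Real.cosh_pos ρ
    positivity
  let g : ℝ → ℝ := fun r => 4 * K * √((Real.cosh r - Real.cosh ρ) / (Real.cosh r - 1))
  let g' : ℝ → ℝ := fun r => 4 * K * ((Real.cosh ρ - 1) * Real.sinh r /
        (2 * √(Real.cosh r - Real.cosh ρ) * (√(Real.cosh r - 1) * (Real.cosh r - 1))))
  have hcont : ContinuousWithinAt g (Ici ρ) ρ := by
    refine ContinuousAt.continuousWithinAt ?_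
    refine continuousAt_const.mul (ContinuousAt.sqrt ?_)
    exact (Real.continuous_cosh.continuousAt.sub continuousAt_const).div
      (Real.continuous_cosh.continuousAt.sub continuousAt_const) hρ1.ne'
  have hderiv : ∀ r ∈ Ioi ρ, HasDerivAt g (g' r) r := fun r hr =>
    (hasDerivAt_sqrt_cosh_ratio hρ hr).const_mul (4 * K)
  have hint0 : ∀ r ∈ Ioi ρ, 0 ≤ (1 / √(Real.cosh r - Real.cosh ρ)) *
        (1 / (r ^ 2 * Real.sinh r) + Real.cosh r / (r * Real.sinh r ^ 2)) := by
    intro r hr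
    have hr0 : 0 < r := hρ.trans hr
    have hS : 0 < Real.sinh r := Real.sinh_pos_iff.2 hr0
    have hC : 0 < Real.cosh r := Real.cosh_pos r
    positivity
  have hle : ∀ r ∈ Ioi ρ, (1 / √(Real.cosh r - Real.cosh ρ)) *
        (1 / (r ^ 2 * Real.sinh r) + Real.cosh r / (r * Real.sinh r ^ 2)) ≤ g' r :=
    fun r hr => Ghalf_integrand_le hρ hr
  have hpos : ∀ r ∈ Ioi ρ, 0 ≤ g' r := fun r hr => (hint0 r hr).trans (hle r hr)
  have hlim : Tendsto g atTop (𝓝 (4 * K)) := by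
    simpa only [mul_one] using (tendsto_sqrt_cosh_ratio (Real.cosh ρ)).const_mul (4 * K)
  have hint : ∫ r in Ioi ρ, g' r = 4 * K := by
    rw [integral_Ioi_of_hasDerivAt_of_nonneg hcont hderiv hpos hlim]
    simp [g]
  have hbound : ∫ r in Ioi ρ, (1 / √(Real.cosh r - Real.cosh ρ)) *
        (1 / (r ^ 2 * Real.sinh r) + Real.cosh r / (r * Real.sinh r ^ 2)) ≤ 4 * K := by
    rw [← hint]
    exact integral_mono_of_nonneg (ae_restrict_of_forall_mem measurableSet_Ioi hint0)
      (integrableOn_Ioi_deriv_of_nonneg hcont hderiv hpos hlim)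
      (ae_restrict_of_forall_mem measurableSet_Ioi hle)
  calc Ghalf ρ ≤ 2 / (√π * (2 * π) ^ ((5 : ℝ) / 2)) * (4 * K) := by
        unfold Ghalf
        gcongr
    _ = _ := by ring
end

section
/- For every ρ > 0, (2/(√π (2π)^{5/2})) ∫_ρ^∞ (1/√(cosh r − cosh ρ)) · (1/(r² sinh r) + cosh r/(r sinh² r)) dr ≤ 1/(4π² sinh³ ρ) + (1/(8π² cosh ρ · cosh(ρ/2)) + √2/(4π² √(1 + cosh ρ))) · (1/sinh ρ). -/
open MeasureTheory Real

lemma three_mul_sinh_le {r : ℝ} (hr : 0 ≤ r) :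
    3 * Real.sinh r ≤ r * (2 + Real.cosh r) := by
  have hd : ∀ x : ℝ, HasDerivAt (fun x : ℝ => x * (2 + Real.cosh x) - 3 * Real.sinh x)
      (2 - 2 * Real.cosh x + x * Real.sinh x) x := fun x =>
    (((hasDerivAt_id x).mul ((Real.hasDerivAt_cosh x).const_add 2)).sub
      ((Real.hasDerivAt_sinh x).const_mul 3)).congr_deriv (by simp only [id]; ring)
  have hd' : ∀ x : ℝ, HasDerivAt (fun x : ℝ => 2 - 2 * Real.cosh x + x * Real.sinh x)
      (x * Real.cosh x - Real.sinh x) x := fun x =>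
    ((((Real.hasDerivAt_cosh x).const_mul 2).const_sub 2).add
      ((hasDerivAt_id x).mul (Real.hasDerivAt_sinh x))).congr_deriv (by simp only [id]; ring)
  have hd'' : ∀ x : ℝ, HasDerivAt (fun x : ℝ => x * Real.cosh x - Real.sinh x)
      (x * Real.sinh x) x := fun x =>
    (((hasDerivAt_id x).mul (Real.hasDerivAt_cosh x)).sub
      (Real.hasDerivAt_sinh x)).congr_deriv (by simp only [id]; ring)
  have nonneg_of_deriv : ∀ f f' : ℝ → ℝ, (∀ x, HasDerivAt f (f' x) x) →
      (∀ x, 0 ≤ x → 0 ≤ f' x) → f 0 = 0 → ∀ x, 0 ≤ x → 0 ≤ f x := by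
    intro f f' hf hf' h0 x hx
    have hm : MonotoneOn f (Set.Ici 0) := by
      refine monotoneOn_of_hasDerivWithinAt_nonneg (f' := f') (convex_Ici 0)
        (fun y _ => (hf y).continuousAt.continuousWithinAt)
        (fun y _ => (hf y).hasDerivWithinAt) ?_
      intro y hy
      rw [interior_Ici] at hy
      exact hf' y (le_of_lt hy)
    have := hm (Set.self_mem_Ici) hx hx
    rwa [h0] at this
  have h2 := nonneg_of_deriv _ _ hd''
    (fun x hx => mul_nonneg hx (Real.sinh_nonneg_iff.2 hx)) (by simp)
  have h1 := nonneg_of_deriv _ _ hd' h2 (by simp)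
  have h0 := nonneg_of_deriv _ _ hd h1 (by simp) r hr
  linarith

lemma inv_sq_mul_sinh_add_le {r : ℝ} (hr : 0 < r) :
    1 / (r ^ 2 * Real.sinh r) + Real.cosh r / (r * Real.sinh r ^ 2)
      ≤ Real.sinh r / (2 * (Real.cosh r - 1) ^ 2) := by
  have hs : 0 < Real.sinh r := Real.sinh_pos_iff.2 hr
  have hx : 1 < Real.cosh r := Real.one_lt_cosh.2 hr.ne'
  have hsq : Real.sinh r ^ 2 = (Real.cosh r - 1) * (Real.cosh r + 1) := by
    rw [Real.sinh_sq]; ring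
  have hq : Real.sinh r / r ≤ (2 + Real.cosh r) / 3 := by
    rw [div_le_div_iff₀ hr (by norm_num)]
    linarith [three_mul_sinh_le hr.le]
  have hq0 : 0 < Real.sinh r / r := div_pos hs hr
  have key : (Real.sinh r / r) ^ 2 + Real.cosh r * (Real.sinh r / r)
      ≤ (Real.cosh r + 1) ^ 2 / 2 := by
    nlinarith [sq_nonneg (Real.cosh r - 1),
      mul_le_mul_of_nonneg_left hq (by linarith : 0 ≤ Real.cosh r),
      pow_le_pow_left₀ hq0.le hq 2]
  have hl : 1 / (r ^ 2 * Real.sinh r) + Real.cosh r / (r * Real.sinh r ^ 2)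
      = ((Real.sinh r / r) ^ 2 + Real.cosh r * (Real.sinh r / r)) / Real.sinh r ^ 3 := by
    field_simp
  have hrr : Real.sinh r / (2 * (Real.cosh r - 1) ^ 2)
      = ((Real.cosh r + 1) ^ 2 / 2) / Real.sinh r ^ 3 := by
    have : Real.cosh r - 1 ≠ 0 := by linarith
    rw [div_eq_div_iff (by positivity) (by positivity)]
    have : Real.sinh r * Real.sinh r ^ 3 = (Real.sinh r ^ 2) ^ 2 := by ring
    rw [this, hsq]; ring
  rw [hl, hrr]
  gcongr

/-- A primitive of `r ↦ sinh r / (2 √(cosh r - cosh ρ) (cosh r - 1)²)` when `k² = cosh ρ - 1`. -/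
noncomputable def comparisonPrimitive (ρ k r : ℝ) : ℝ :=
  (√(Real.cosh r - Real.cosh ρ) / (k ^ 2 * (√(Real.cosh r - Real.cosh ρ) ^ 2 + k ^ 2))
    + Real.arctan (√(Real.cosh r - Real.cosh ρ) / k) / k ^ 3) / 2

lemma hasDerivAt_comparisonPrimitive {ρ k r : ℝ} (hρ : 0 < ρ) (hk : 0 < k)
    (hkρ : k ^ 2 = Real.cosh ρ - 1) (hr : ρ < r) :
    HasDerivAt (comparisonPrimitive ρ k)
      (1 / √(Real.cosh r - Real.cosh ρ) * (Real.sinh r / (2 * (Real.cosh r - 1) ^ 2))) r := by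
  have hy : 0 < Real.cosh r - Real.cosh ρ := by
    rw [sub_pos, Real.cosh_lt_cosh, abs_of_pos hρ, abs_of_pos (hρ.trans hr)]
    exact hr
  have hw : HasDerivAt (fun r => √(Real.cosh r - Real.cosh ρ))
      (Real.sinh r / (2 * √(Real.cosh r - Real.cosh ρ))) r :=
    ((Real.hasDerivAt_cosh r).sub_const _).sqrt hy.ne'
  have hH : ∀ w : ℝ, HasDerivAt
      (fun w : ℝ => (w / (k ^ 2 * (w ^ 2 + k ^ 2)) + Real.arctan (w / k) / k ^ 3) / 2)
      (1 / (w ^ 2 + k ^ 2) ^ 2) w := by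
    intro w
    have hne : k ^ 2 * (w ^ 2 + k ^ 2) ≠ 0 := by positivity
    have h1 := (hasDerivAt_id w).div
      ((((hasDerivAt_pow 2 w).add_const (k ^ 2)).const_mul (k ^ 2))) hne
    have h2 := (((hasDerivAt_id w).div_const k).arctan).div_const (k ^ 3)
    refine ((h1.add h2).div_const 2).congr_deriv ?_
    have h3 : w ^ 2 + k ^ 2 ≠ 0 := by positivity
    have h4 : k ^ 2 + w ^ 2 ≠ 0 := by positivity
    have h5 : 1 + (w / k) ^ 2 = (w ^ 2 + k ^ 2) / k ^ 2 := by field_simp; ring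
    simp only [id]
    rw [h5]
    field_simp
    push_cast
    ring
  have hc := (hH _).comp r hw
  refine hc.congr_deriv ?_
  have e : √(Real.cosh r - Real.cosh ρ) ^ 2 + k ^ 2 = Real.cosh r - 1 := by
    rw [Real.sq_sqrt hy.le, hkρ]; ring
  rw [e]
  have : Real.cosh r - 1 ≠ 0 := by rw [← e]; positivity
  have : √(Real.cosh r - Real.cosh ρ) ≠ 0 := by positivity
  field_simp

lemma continuous_comparisonPrimitive {k : ℝ} (ρ : ℝ) (hk : 0 < k) :
    Continuous (comparisonPrimitive ρ k) := by
  unfold comparisonPrimitive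
  have hw : Continuous fun r => √(Real.cosh r - Real.cosh ρ) :=
    (Real.continuous_cosh.sub continuous_const).sqrt
  refine Continuous.div_const (Continuous.add (hw.div (by fun_prop) fun r => by positivity) ?_) 2
  exact (Real.continuous_arctan.comp (hw.div_const k)).div_const _

lemma tendsto_comparisonPrimitive_atTop {k : ℝ} (ρ : ℝ) (hk : 0 < k) :
    Filter.Tendsto (comparisonPrimitive ρ k) Filter.atTop (nhds (π / (4 * k ^ 3))) := by
  have hcosh : Filter.Tendsto Real.cosh Filter.atTop Filter.atTop := by
    refine Filter.tendsto_atTop_mono (fun x => ?_)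
      (Real.tendsto_exp_atTop.atTop_div_const (two_pos))
    rw [Real.cosh_eq]
    linarith [Real.exp_pos (-x)]
  have hw : Filter.Tendsto (fun r => √(Real.cosh r - Real.cosh ρ)) Filter.atTop Filter.atTop :=
    Real.tendsto_sqrt_atTop.comp (Filter.tendsto_atTop_add_const_right _ (-Real.cosh ρ) hcosh)
  have hat : Filter.Tendsto (fun w : ℝ => Real.arctan (w / k) / k ^ 3) Filter.atTop
      (nhds (π / 2 / k ^ 3)) :=
    ((Real.tendsto_arctan_atTop.mono_right nhdsWithin_le_nhds).comp
      (Filter.tendsto_id.atTop_div_const hk)).div_const _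
  have hfr : Filter.Tendsto (fun w : ℝ => w / (k ^ 2 * (w ^ 2 + k ^ 2))) Filter.atTop
      (nhds 0) := by
    refine tendsto_of_tendsto_of_tendsto_of_le_of_le' tendsto_const_nhds
      ((tendsto_inv_atTop_zero (𝕜 := ℝ)).const_mul (1 / k ^ 2) |>.trans (by simp)) ?_ ?_
    · filter_upwards [Filter.eventually_gt_atTop 0] with w hw0
      positivity
    · filter_upwards [Filter.eventually_gt_atTop 0] with w hw0
      rw [← one_div, one_div_mul_one_div, div_le_div_iff₀ (by positivity) (by positivity)]
      nlinarith [pow_pos hk 4]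
  have h := ((hfr.add hat).div_const 2).comp hw
  have e : (0 + π / 2 / k ^ 3) / 2 = π / (4 * k ^ 3) := by field_simp; norm_num
  rw [e] at h
  exact h

lemma Ghalf_le_inv_sinh_half_cube {ρ : ℝ} (hρ : 0 < ρ) :
    Ghalf ρ ≤ 1 / (32 * π ^ 2 * Real.sinh (ρ / 2) ^ 3) := by
  have hsh : 0 < Real.sinh (ρ / 2) := Real.sinh_pos_iff.2 (by linarith)
  obtain ⟨k, hk⟩ : ∃ k, k = √2 * Real.sinh (ρ / 2) := ⟨_, rfl⟩
  have hk0 : 0 < k := by rw [hk]; positivity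
  have h2 : √2 ^ 2 = 2 := Real.sq_sqrt (by norm_num)
  have hkρ : k ^ 2 = Real.cosh ρ - 1 := by
    have h := Real.cosh_two_mul (ρ / 2)
    rw [mul_div_cancel₀ ρ two_ne_zero, Real.cosh_sq] at h
    rw [hk, mul_pow, h2, h]; ring
  have hderiv := fun r (hr : r ∈ Set.Ioi ρ) => hasDerivAt_comparisonPrimitive hρ hk0 hkρ hr
  have hnonneg : ∀ r ∈ Set.Ioi ρ, 0 ≤ 1 / √(Real.cosh r - Real.cosh ρ) *
      (Real.sinh r / (2 * (Real.cosh r - 1) ^ 2)) := fun r hr => by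
    have : 0 ≤ Real.sinh r := Real.sinh_nonneg_iff.2 (hρ.trans hr).le
    positivity
  have hcont := (continuous_comparisonPrimitive ρ hk0).continuousWithinAt (s := Set.Ici ρ) (x := ρ)
  have hlim := tendsto_comparisonPrimitive_atTop ρ hk0
  have hint := integrableOn_Ioi_deriv_of_nonneg hcont hderiv hnonneg hlim
  have hval := integral_Ioi_of_hasDerivAt_of_nonneg hcont hderiv hnonneg hlim
  have hzero : comparisonPrimitive ρ k ρ = 0 := by simp [comparisonPrimitive]
  rw [hzero, sub_zero] at hval
  have hpow : (2 * π) ^ ((5 : ℝ) / 2) = 4 * π ^ 2 * (√2 * √π) := by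
    have : (5 : ℝ) / 2 = (2 : ℕ) + 1 / 2 := by norm_num
    rw [this, Real.rpow_add (by positivity), Real.rpow_natCast, ← Real.sqrt_eq_rpow,
      Real.sqrt_mul (by norm_num)]
    ring
  have hle : Ghalf ρ ≤ 2 / (√π * (2 * π) ^ ((5 : ℝ) / 2)) * (π / (4 * k ^ 3)) := by
    unfold Ghalf
    rw [← hval]
    refine mul_le_mul_of_nonneg_left ?_ (by positivity)
    refine integral_mono_of_nonneg ?_ hint ?_
    · filter_upwards [ae_restrict_mem measurableSet_Ioi] with r hr
      have hr0 : 0 < r := hρ.trans hr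
      have : 0 < Real.sinh r := Real.sinh_pos_iff.2 hr0
      have : 0 < Real.cosh r := Real.cosh_pos r
      simp only [Pi.zero_apply]
      positivity
    · filter_upwards [ae_restrict_mem measurableSet_Ioi] with r hr
      exact mul_le_mul_of_nonneg_left (inv_sq_mul_sinh_add_le (hρ.trans hr)) (by positivity)
  refine hle.trans_eq ?_
  have hπ : √π ^ 2 = π := Real.sq_sqrt pi_pos.le
  have h4 : √2 ^ 4 = 4 := by rw [show 4 = 2 * 2 from rfl, pow_mul, h2]; norm_num
  rw [hpow, hk, div_mul_div_comm, div_eq_div_iff (by positivity) (by positivity)]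
  calc _ = 64 * π ^ 3 * Real.sinh (ρ / 2) ^ 3 := by ring
    _ = 16 * π ^ 2 * √π ^ 2 * √2 ^ 4 * Real.sinh (ρ / 2) ^ 3 := by rw [hπ, h4]; ring
    _ = _ := by ring

theorem Ghalf_estimate_three (ρ : ℝ) (hρ : 0 < ρ) :
    Ghalf ρ ≤ 1 / (4 * π ^ 2 * Real.sinh ρ ^ 3)
      + (1 / (8 * π ^ 2 * Real.cosh ρ * Real.cosh (ρ / 2))
          + Real.sqrt 2 / (4 * π ^ 2 * Real.sqrt (1 + Real.cosh ρ))) * (1 / Real.sinh ρ) := by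
  refine (Ghalf_le_inv_sinh_half_cube hρ).trans ?_
  have hsh : 0 < Real.sinh (ρ / 2) := Real.sinh_pos_iff.2 (by linarith)
  have hch : 1 < Real.cosh (ρ / 2) := Real.one_lt_cosh.2 (by linarith)
  have hx : 0 < Real.cosh ρ := Real.cosh_pos ρ
  have hsinh : Real.sinh ρ = 2 * Real.sinh (ρ / 2) * Real.cosh (ρ / 2) := by
    rw [← Real.sinh_two_mul, mul_div_cancel₀ ρ two_ne_zero]
  have hcs := Real.cosh_sq (ρ / 2)
  have hcosh : 1 + Real.cosh ρ = 2 * Real.cosh (ρ / 2) ^ 2 := by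
    have h := Real.cosh_two_mul (ρ / 2)
    rw [mul_div_cancel₀ ρ two_ne_zero] at h
    linarith
  rw [hcosh, Real.sqrt_mul (by norm_num), Real.sqrt_sq (by linarith), hsinh]
  generalize Real.cosh ρ = x at *
  generalize Real.cosh (ρ / 2) = c at *
  generalize Real.sinh (ρ / 2) = s at *
  have hc0 : 0 < c := by linarith
  have hfirst : 1 / (32 * π ^ 2 * s ^ 3)
      ≤ 1 / (4 * π ^ 2 * (2 * s * c) ^ 3)
        + √2 / (4 * π ^ 2 * (√2 * c)) * (1 / (2 * s * c)) := by
    have e : 1 / (4 * π ^ 2 * (2 * s * c) ^ 3)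
        + √2 / (4 * π ^ 2 * (√2 * c)) * (1 / (2 * s * c))
        = (1 + 4 * s ^ 2 * c) / c ^ 3 * (1 / (32 * π ^ 2 * s ^ 3)) := by
      field_simp
      ring
    rw [e]
    refine le_mul_of_one_le_left (by positivity) ?_
    rw [one_le_div (by positivity)]
    have : s ^ 2 = c ^ 2 - 1 := by linarith
    rw [this]
    nlinarith [mul_pos (sub_pos.2 hch) hc0, mul_pos (mul_pos (sub_pos.2 hch) hc0) hc0]
  have hrest : 0 ≤ 1 / (8 * π ^ 2 * x * c) * (1 / (2 * s * c)) := by positivity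
  rw [add_mul]
  linarith
end

section
/- There exists a constant C > 0 such that for every ρ > 1, (2/(√π (2π)^{5/2})) ∫_ρ^∞ (1/√(cosh r − cosh ρ)) · (1/(r² sinh r) + cosh r/(r sinh² r)) dr ≤ C · ρ^{−1} e^{−3ρ/2}. -/
open MeasureTheory Real

theorem exp_div_four_le_sinh {r : ℝ} (hr : 1 ≤ r) : exp r / 4 ≤ sinh r := by
  have h1 : 2 ≤ exp r := by linarith [add_one_le_exp r]
  have h2 : exp r * exp (-r) = 1 := by rw [← exp_add]; simp
  have h3 : exp (-r) ≤ 1 / 2 := by nlinarith [exp_pos (-r)]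
  rw [sinh_eq]
  linarith

theorem sub_mul_sinh_le_cosh_sub_cosh {ρ r : ℝ} (hρ : 0 ≤ ρ) (h : ρ ≤ r) :
    (r - ρ) * sinh ρ ≤ cosh r - cosh ρ := by
  have hx : 0 ≤ r - ρ := by linarith
  have h1 : cosh r = cosh (r - ρ) * cosh ρ + sinh (r - ρ) * sinh ρ := by
    rw [← cosh_add]; ring_nf
  have h2 : (r - ρ) * sinh ρ ≤ sinh (r - ρ) * sinh ρ :=
    mul_le_mul_of_nonneg_right (self_le_sinh_iff.2 hx) (sinh_nonneg_iff.2 hρ)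
  have h3 : 0 ≤ (cosh (r - ρ) - 1) * cosh ρ :=
    mul_nonneg (by linarith [one_le_cosh (r - ρ)]) (cosh_pos ρ).le
  linarith

theorem one_div_sqrt_cosh_sub_cosh_le {ρ r : ℝ} (hρ : 1 ≤ ρ) (h : ρ < r) :
    1 / √(cosh r - cosh ρ) ≤ 2 * exp (-ρ / 2) * (r - ρ) ^ ((1 : ℝ) / 2 - 1) := by
  have hx : 0 < r - ρ := by linarith
  have h1 : (r - ρ) * (exp ρ / 4) ≤ cosh r - cosh ρ :=
    (mul_le_mul_of_nonneg_left (exp_div_four_le_sinh hρ) hx.le).trans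
      (sub_mul_sinh_le_cosh_sub_cosh (by linarith) h.le)
  have h2 : √((r - ρ) * (exp ρ / 4)) = √(r - ρ) * (exp (ρ / 2) / 2) := by
    rw [sqrt_mul hx.le]
    congr 1
    rw [sqrt_eq_iff_mul_self_eq_of_pos (by positivity)]
    have : exp ρ = exp (ρ / 2) * exp (ρ / 2) := by rw [← exp_add]; ring_nf
    rw [this]; ring
  have h3 : (r - ρ) ^ ((1 : ℝ) / 2 - 1) = (√(r - ρ))⁻¹ := by
    rw [sqrt_eq_rpow, ← rpow_neg hx.le]; norm_num
  have hs : 0 < √(r - ρ) := sqrt_pos.2 hx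
  calc 1 / √(cosh r - cosh ρ) ≤ 1 / √((r - ρ) * (exp ρ / 4)) :=
        one_div_le_one_div_of_le (sqrt_pos.2 (by positivity)) (sqrt_le_sqrt h1)
    _ = 2 * exp (-ρ / 2) * (r - ρ) ^ ((1 : ℝ) / 2 - 1) := by
        rw [h2, h3, neg_div, exp_neg]; field_simp

theorem one_div_sq_mul_sinh_add_le {ρ r : ℝ} (hρ : 1 ≤ ρ) (h : ρ < r) :
    1 / (r ^ 2 * sinh r) + cosh r / (r * sinh r ^ 2) ≤ 20 * ρ⁻¹ * exp (-r) := by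
  have hρ0 : 0 < ρ := by linarith
  have hr0 : 0 < r := by linarith
  have hs := exp_div_four_le_sinh (hρ.trans h.le)
  have he := exp_pos r
  have hc : cosh r ≤ exp r := by
    rw [cosh_eq]; linarith [exp_le_exp.2 (by linarith : -r ≤ r)]
  have hrr : ρ ≤ r ^ 2 := by nlinarith
  have h1 : 1 / (r ^ 2 * sinh r) ≤ 1 / (ρ * (exp r / 4)) := by gcongr
  have h2 : cosh r / (r * sinh r ^ 2) ≤ exp r / (ρ * (exp r / 4) ^ 2) := by gcongr
  refine (add_le_add h1 h2).trans (le_of_eq ?_)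
  rw [exp_neg]
  field_simp
  norm_num

theorem integrableOn_exp_neg_mul_rpow_shift (ρ : ℝ) :
    IntegrableOn (fun r : ℝ => exp (-(r - ρ)) * (r - ρ) ^ ((1 : ℝ) / 2 - 1)) (Set.Ioi ρ) := by
  have h := (measurePreserving_sub_right volume ρ).integrableOn_comp_preimage
    (measurableEmbedding_subRight ρ)
    (f := fun x : ℝ => exp (-x) * x ^ ((1 : ℝ) / 2 - 1)) (s := Set.Ioi 0)
  have h' := h.2 (GammaIntegral_convergent one_half_pos)
  simpa [Function.comp_def] using h'

theorem setIntegral_exp_neg_mul_rpow_shift (ρ : ℝ) :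
    ∫ r in Set.Ioi ρ, exp (-(r - ρ)) * (r - ρ) ^ ((1 : ℝ) / 2 - 1) = √π := by
  have h := (measurePreserving_sub_right volume ρ).setIntegral_preimage_emb
    (measurableEmbedding_subRight ρ)
    (fun x : ℝ => exp (-x) * x ^ ((1 : ℝ) / 2 - 1)) (Set.Ioi 0)
  rw [← Gamma_eq_integral one_half_pos, Gamma_one_half_eq] at h
  simpa using h

theorem Ghalf_decay :
    ∃ C : ℝ, 0 < C ∧ ∀ ρ : ℝ, 1 < ρ →
      Ghalf ρ ≤ C * (ρ⁻¹ * Real.exp (-3 * ρ / 2)) := by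
  set K : ℝ := 2 / (√π * (2 * π) ^ ((5 : ℝ) / 2)) with hK
  have hK0 : 0 < K := by positivity
  refine ⟨K * (40 * √π), by positivity, fun ρ hρ => ?_⟩
  have hρ0 : 0 < ρ := by linarith
  have hint : ∫ r in Set.Ioi ρ, (1 / √(cosh r - cosh ρ)) *
      (1 / (r ^ 2 * sinh r) + cosh r / (r * sinh r ^ 2)) ≤
      ∫ r in Set.Ioi ρ, (40 * (ρ⁻¹ * exp (-3 * ρ / 2))) *
        (exp (-(r - ρ)) * (r - ρ) ^ ((1 : ℝ) / 2 - 1)) := by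
    refine integral_mono_of_nonneg ?_
      ((integrableOn_exp_neg_mul_rpow_shift ρ).const_mul _) ?_
    · filter_upwards [ae_restrict_mem measurableSet_Ioi] with r hr
      have hr0 : 0 < r := hρ0.trans hr
      have := sinh_pos_iff.2 hr0
      have := cosh_pos r
      simp only [Pi.zero_apply]
      positivity
    · filter_upwards [ae_restrict_mem measurableSet_Ioi] with r hr
      have hr0 : 0 < r := hρ0.trans hr
      have hx : 0 < r - ρ := sub_pos.2 hr
      have := sinh_pos_iff.2 hr0
      have := cosh_pos r
      have hexp : exp (-ρ / 2) * exp (-r) = exp (-3 * ρ / 2) * exp (-(r - ρ)) := by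
        rw [← exp_add, ← exp_add]; ring_nf
      calc _ ≤ (2 * exp (-ρ / 2) * (r - ρ) ^ ((1 : ℝ) / 2 - 1)) * (20 * ρ⁻¹ * exp (-r)) :=
            mul_le_mul (one_div_sqrt_cosh_sub_cosh_le hρ.le hr)
              (one_div_sq_mul_sinh_add_le hρ.le hr) (by positivity) (by positivity)
        _ = _ := by
            linear_combination (40 * ρ⁻¹ * (r - ρ) ^ ((1 : ℝ) / 2 - 1)) * hexp
  rw [integral_const_mul, setIntegral_exp_neg_mul_rpow_shift] at hint
  calc Ghalf ρ ≤ K * (40 * (ρ⁻¹ * exp (-3 * ρ / 2)) * √π) :=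
        mul_le_mul_of_nonneg_left hint hK0.le
    _ = K * (40 * √π) * (ρ⁻¹ * exp (-3 * ρ / 2)) := by ring
end

section
/- There exists a constant C₇ > 0 such that for every u ∈ C₀^∞(B⁴), ∫_{B⁴} |Δu(x)|² dx − 9 ∫_{B⁴} u(x)²/(1 − |x|²)⁴ dx ≥ C₇ ∫_{B⁴} u(x)² dx. -/
open MeasureTheory Real

noncomputable section

/-- The Euclidean space `ℝ⁴`. -/
abbrev E4 := EuclideanSpace ℝ (Fin 4)

/-- The Euclidean Laplacian on `ℝ⁴`. -/
def lapE (u : E4 → ℝ) (x : E4) : ℝ :=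
  ∑ i, fderiv ℝ (fun y => fderiv ℝ u y (EuclideanSpace.single i 1)) x (EuclideanSpace.single i 1)

end

noncomputable section

/-- The `i`-th partial derivative on `ℝ⁴`. -/
def partialDeriv (u : E4 → ℝ) (i : Fin 4) (x : E4) : ℝ :=
  fderiv ℝ u x (EuclideanSpace.single i 1)

/-- The vector field whose divergence is the defect between `|Δu|² - 9u²/w⁴ - 30u²/w³` and a sum of
squares, where `w = 1 - ‖x‖²`. -/
def rellichField (u : E4 → ℝ) (i : Fin 4) (x : E4) : ℝ :=
  8 * ((∑ j, x j * partialDeriv u j x) * partialDeriv u i x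
      - x i * (∑ j, partialDeriv u j x ^ 2) / 2) * (1 - ‖x‖ ^ 2)⁻¹
    + 18 * (u x * partialDeriv u i x) * (1 - ‖x‖ ^ 2)⁻¹ ^ 2
    + 30 * (x i * u x ^ 2) * (1 - ‖x‖ ^ 2)⁻¹ ^ 3

end

section

variable {u : E4 → ℝ}

theorem contDiff_partialDeriv (hu : ContDiff ℝ (⊤ : ℕ∞) u) (i : Fin 4) :
    ContDiff ℝ (⊤ : ℕ∞) (partialDeriv u i) :=
  (hu.fderiv_right (m := (⊤ : ℕ∞)) (by simp)).clm_apply contDiff_const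

theorem partialDeriv_eq_zero {x : E4} (hx : x ∉ tsupport u) (i : Fin 4) :
    partialDeriv u i x = 0 := by
  have h : fderiv ℝ u x = 0 := by
    by_contra h
    exact hx (support_fderiv_subset ℝ h)
  simp [partialDeriv, h]

theorem tsupport_partialDeriv_subset (i : Fin 4) : tsupport (partialDeriv u i) ⊆ tsupport u :=
  closure_minimal (fun _ h => by_contra fun hx => h (partialDeriv_eq_zero hx i))
    (isClosed_tsupport u)

theorem partialDeriv_comm (hu : ContDiff ℝ (⊤ : ℕ∞) u) (i j : Fin 4) (x : E4) :
    partialDeriv (partialDeriv u i) j x = partialDeriv (partialDeriv u j) i x := by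
  have key : ∀ a b : Fin 4, partialDeriv (partialDeriv u a) b x =
      fderiv ℝ (fderiv ℝ u) x (EuclideanSpace.single b 1) (EuclideanSpace.single a 1) := by
    intro a b
    have hd : DifferentiableAt ℝ (fderiv ℝ u) x :=
      (hu.fderiv_right (m := (⊤ : ℕ∞)) (by simp)).differentiable (by simp) x
    have h := (hd.hasFDerivAt.clm_apply
      (hasFDerivAt_const (EuclideanSpace.single a (1 : ℝ)) x)).fderiv
    change fderiv ℝ (fun y => fderiv ℝ u y (EuclideanSpace.single a 1)) x _ = _
    rw [h]
    simp
  have hs : IsSymmSndFDerivAt ℝ u x :=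
    hu.contDiffAt.isSymmSndFDerivAt (by
      rw [minSmoothness_of_isRCLikeNormedField]; exact WithTop.coe_le_coe.2 le_top)
  rw [key, key, hs]

theorem one_sub_norm_sq_pos {x : E4} (hx : x ∈ Metric.ball (0 : E4) 1) : 0 < 1 - ‖x‖ ^ 2 := by
  have h : ‖x‖ < 1 := by simpa using hx
  nlinarith [norm_nonneg x]

theorem contDiff_of_contDiffOn_ball {f : E4 → ℝ} {K : Set E4} {n : ℕ∞}
    (hK : IsClosed K) (hKb : K ⊆ Metric.ball (0 : E4) 1) (hf0 : ∀ x ∉ K, f x = 0)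
    (hf : ∀ x ∈ Metric.ball (0 : E4) 1, ContDiffAt ℝ n f x) : ContDiff ℝ n f := by
  refine contDiff_iff_contDiffAt.2 fun x => ?_
  by_cases hx : x ∈ K
  · exact hf x (hKb hx)
  · refine (contDiffAt_const (c := (0 : ℝ))).congr_of_eventuallyEq ?_
    filter_upwards [hK.isOpen_compl.mem_nhds hx] with y hy using hf0 y hy

theorem integral_partialDeriv_eq_zero {f : E4 → ℝ} (hf : ContDiff ℝ (⊤ : ℕ∞) f)
    (hc : HasCompactSupport f) (i : Fin 4) : ∫ x, partialDeriv f i x = 0 := by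
  have hi : Integrable (partialDeriv f i) :=
    (contDiff_partialDeriv hf i).continuous.integrable_of_hasCompactSupport
      (hc.mono' (subset_closure.trans (tsupport_partialDeriv_subset i)))
  have h := integral_mul_fderiv_eq_neg_fderiv_mul_of_integrable (μ := (volume : Measure E4))
    (f := fun _ : E4 => (1 : ℝ)) (g := f) (v := EuclideanSpace.single i 1)
    (by simp) (by simp only [one_mul]; exact hi)
    (by simpa using hf.continuous.integrable_of_hasCompactSupport hc)
    (fun x _ => differentiableAt_const _) (fun x _ => hf.differentiable (by simp) x)
  simpa [partialDeriv] using h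

theorem contDiffAt_inv_one_sub_norm_sq {x : E4} (hx : x ∈ Metric.ball (0 : E4) 1) :
    ContDiffAt ℝ (⊤ : ℕ∞) (fun y : E4 => (1 - ‖y‖ ^ 2)⁻¹) x :=
  (contDiffAt_const.sub (contDiff_norm_sq ℝ).contDiffAt).inv (one_sub_norm_sq_pos hx).ne'

theorem rellichField_eq_zero {x : E4} (hx : x ∉ tsupport u) (i : Fin 4) :
    rellichField u i x = 0 := by
  simp [rellichField, partialDeriv_eq_zero hx, image_eq_zero_of_notMem_tsupport hx]

theorem contDiff_rellichField (hu : ContDiff ℝ (⊤ : ℕ∞) u)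
    (hs : tsupport u ⊆ Metric.ball (0 : E4) 1) (i : Fin 4) :
    ContDiff ℝ (⊤ : ℕ∞) (rellichField u i) := by
  refine contDiff_of_contDiffOn_ball (isClosed_tsupport u) hs
    (fun x hx => rellichField_eq_zero hx i) fun x hx => ?_
  have hw := contDiffAt_inv_one_sub_norm_sq hx
  have hp := fun j => (contDiff_partialDeriv hu j).contDiffAt (x := x)
  have hu' := hu.contDiffAt (x := x)
  have hc : ∀ j : Fin 4, ContDiffAt ℝ (⊤ : ℕ∞) (fun y : E4 => y j) x := fun j => by fun_prop
  have h1 : ContDiffAt ℝ (⊤ : ℕ∞) (fun y : E4 => ∑ j, y j * partialDeriv u j y) x :=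
    ContDiffAt.sum fun j _ => (hc j).mul (hp j)
  have h2 : ContDiffAt ℝ (⊤ : ℕ∞) (fun y : E4 => ∑ j, partialDeriv u j y ^ 2) x :=
    ContDiffAt.sum fun j _ => (hp j).pow 2
  exact (((contDiffAt_const.mul ((h1.mul (hp i)).sub (((hc i).mul h2).div_const 2))).mul hw).add
    ((contDiffAt_const.mul (hu'.mul (hp i))).mul (hw.pow 2))).add
    ((contDiffAt_const.mul ((hc i).mul (hu'.pow 2))).mul (hw.pow 3))

theorem partialDeriv_eq_of_hasDerivAt {f : E4 → ℝ} {x : E4} {i : Fin 4} {f' : ℝ}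
    (hf : DifferentiableAt ℝ f x)
    (h : HasDerivAt (fun t : ℝ => f (x + t • EuclideanSpace.single i (1 : ℝ))) f' 0) :
    partialDeriv f i x = f' :=
  (hf.hasFDerivAt.hasLineDerivAt (EuclideanSpace.single i (1 : ℝ))).unique h

theorem hasDerivAt_comp_line {f : E4 → ℝ} {x : E4} (hf : DifferentiableAt ℝ f x) (i : Fin 4) :
    HasDerivAt (fun t : ℝ => f (x + t • EuclideanSpace.single i (1 : ℝ)))
      (partialDeriv f i x) 0 :=
  hf.hasFDerivAt.hasLineDerivAt (EuclideanSpace.single i (1 : ℝ))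

theorem hasDerivAt_coord_line (x : E4) (i j : Fin 4) :
    HasDerivAt (fun t : ℝ => (x + t • EuclideanSpace.single i (1 : ℝ)) j)
      (if j = i then 1 else 0) 0 := by
  have h := ((hasDerivAt_id (0 : ℝ)).mul_const (if j = i then (1 : ℝ) else 0)).const_add (x j)
  simpa [Pi.single_apply] using h

theorem hasDerivAt_inv_line {x : E4} (hx : x ∈ Metric.ball (0 : E4) 1) (i : Fin 4) :
    HasDerivAt (fun t : ℝ => (1 - ‖x + t • EuclideanSpace.single i (1 : ℝ)‖ ^ 2)⁻¹)
      (2 * x i * (1 - ‖x‖ ^ 2)⁻¹ ^ 2) 0 := by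
  have h1 : HasDerivAt (fun t : ℝ => ‖x + t • EuclideanSpace.single i (1 : ℝ)‖ ^ 2)
      (2 * x i) 0 := by
    have h := HasDerivAt.fun_sum (u := Finset.univ)
      fun j _ => (hasDerivAt_coord_line x i j).fun_pow 2
    simp only [zero_smul, add_zero] at h
    refine (h.congr_deriv ?_).congr_of_eventuallyEq (.of_forall fun t =>
      EuclideanSpace.real_norm_sq_eq _)
    simp
  have h2 := (h1.const_sub 1).fun_inv (by simpa using (one_sub_norm_sq_pos hx).ne')
  refine h2.congr_deriv ?_
  simp [div_eq_mul_inv]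

theorem partialDeriv_rellichField (hu : ContDiff ℝ (⊤ : ℕ∞) u)
    (hs : tsupport u ⊆ Metric.ball (0 : E4) 1) {x : E4} (hx : x ∈ Metric.ball (0 : E4) 1)
    (i : Fin 4) :
    partialDeriv (rellichField u i) i x =
      8 * ((partialDeriv u i x + ∑ j, x j * partialDeriv (partialDeriv u j) i x)
            * partialDeriv u i x
          + (∑ j, x j * partialDeriv u j x) * partialDeriv (partialDeriv u i) i x
          - (∑ j, partialDeriv u j x ^ 2) / 2
          - x i * ∑ j, partialDeriv u j x * partialDeriv (partialDeriv u j) i x)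
        * (1 - ‖x‖ ^ 2)⁻¹
      + 16 * ((∑ j, x j * partialDeriv u j x) * partialDeriv u i x
          - x i * (∑ j, partialDeriv u j x ^ 2) / 2) * x i * (1 - ‖x‖ ^ 2)⁻¹ ^ 2
      + 18 * (partialDeriv u i x ^ 2 + u x * partialDeriv (partialDeriv u i) i x)
        * (1 - ‖x‖ ^ 2)⁻¹ ^ 2
      + 72 * u x * partialDeriv u i x * x i * (1 - ‖x‖ ^ 2)⁻¹ ^ 3
      + 30 * (u x ^ 2 + 2 * x i * u x * partialDeriv u i x) * (1 - ‖x‖ ^ 2)⁻¹ ^ 3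
      + 180 * x i ^ 2 * u x ^ 2 * (1 - ‖x‖ ^ 2)⁻¹ ^ 4 := by
  refine partialDeriv_eq_of_hasDerivAt
    ((contDiff_rellichField hu hs i).differentiable (by simp) x) ?_
  have hw := hasDerivAt_inv_line hx i
  have hp := fun j =>
    hasDerivAt_comp_line ((contDiff_partialDeriv hu j).differentiable (by simp) x) i
  have hu' := hasDerivAt_comp_line (hu.differentiable (by simp) x) i
  have hc := hasDerivAt_coord_line x i
  have h1 := HasDerivAt.fun_sum (u := Finset.univ) fun j _ => (hc j).fun_mul (hp j)
  have h2 := HasDerivAt.fun_sum (u := Finset.univ) fun j _ => (hp j).fun_pow 2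
  have h := ((((h1.fun_mul (hp i)).fun_sub
    (((hc i).fun_mul h2).div_const 2)).const_mul 8).fun_mul hw).fun_add
    (((hu'.fun_mul (hp i)).const_mul 18).fun_mul (hw.fun_pow 2)) |>.fun_add
    ((((hc i).fun_mul (hu'.fun_pow 2)).const_mul 30).fun_mul (hw.fun_pow 3))
  refine h.congr_deriv ?_
  simp only [zero_smul, add_zero, Finset.sum_add_distrib, ite_mul, one_mul, zero_mul,
    Finset.sum_ite_eq', Finset.mem_univ, if_true, Nat.cast_ofNat, Nat.add_one_sub_one, pow_one,
    mul_assoc, ← Finset.mul_sum]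
  ring

theorem rellich_pointwise (hu : ContDiff ℝ (⊤ : ℕ∞) u)
    (hs : tsupport u ⊆ Metric.ball (0 : E4) 1) {x : E4} (hx : x ∈ Metric.ball (0 : E4) 1) :
    0 ≤ |lapE u x| ^ 2 - 9 * (u x ^ 2 / (1 - ‖x‖ ^ 2) ^ 4) - 30 * u x ^ 2
      + ∑ i, partialDeriv (rellichField u i) i x := by
  have hw := one_sub_norm_sq_pos hx
  have hlap : lapE u x = ∑ i, partialDeriv (partialDeriv u i) i x := rfl
  simp only [partialDeriv_rellichField hu hs hx, sq_abs, hlap, div_eq_mul_inv, ← inv_pow]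
  have hs1 : 1 ≤ (1 - ‖x‖ ^ 2)⁻¹ := (one_le_inv₀ hw).2 (by nlinarith [norm_nonneg x])
  have hrel : (1 - ‖x‖ ^ 2)⁻¹ * (1 - ∑ i, x i ^ 2) = 1 := by
    rw [← EuclideanSpace.real_norm_sq_eq]
    exact inv_mul_cancel₀ hw.ne'
  have hs3 : 0 ≤ u x ^ 2 * ((1 - ‖x‖ ^ 2)⁻¹ ^ 3 - 1) :=
    mul_nonneg (sq_nonneg _) (sub_nonneg.2 (one_le_pow₀ hs1))
  have hsym := fun i j => partialDeriv_comm hu i j x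
  have hsq : 0 ≤ ((∑ i, partialDeriv (partialDeriv u i) i x)
        + 4 * (1 - ‖x‖ ^ 2)⁻¹ * (∑ i, x i * partialDeriv u i x)
        + 9 * u x * (1 - ‖x‖ ^ 2)⁻¹ ^ 2) ^ 2
      + 10 * ∑ i, ((1 - ‖x‖ ^ 2)⁻¹ * partialDeriv u i x
        + 3 * x i * u x * (1 - ‖x‖ ^ 2)⁻¹ ^ 2) ^ 2 := by
    positivity
  generalize (1 - ‖x‖ ^ 2)⁻¹ = s at *
  simp only [Fin.sum_univ_four, hsym 1 0, hsym 2 0, hsym 3 0, hsym 2 1, hsym 3 1, hsym 3 2] at *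
  refine (add_nonneg hsq (mul_nonneg (by norm_num : (0 : ℝ) ≤ 30) hs3)).trans_eq ?_
  linear_combination (-8 * (partialDeriv u 0 x ^ 2 + partialDeriv u 1 x ^ 2
    + partialDeriv u 2 x ^ 2 + partialDeriv u 3 x ^ 2) * s + 90 * u x ^ 2 * s ^ 3) * hrel

end

theorem improved_hardy_rellich :
    ∃ C₇ : ℝ, 0 < C₇ ∧ ∀ u : E4 → ℝ, ContDiff ℝ (⊤ : ℕ∞) u → HasCompactSupport u →
      tsupport u ⊆ Metric.ball (0 : E4) 1 →
      (∫ x in Metric.ball (0 : E4) 1, |lapE u x| ^ 2)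
          - 9 * (∫ x in Metric.ball (0 : E4) 1, u x ^ 2 / (1 - ‖x‖ ^ 2) ^ 4)
        ≥ C₇ * ∫ x in Metric.ball (0 : E4) 1, u x ^ 2 := by
  refine ⟨30, by norm_num, fun u hu hc hs => ?_⟩
  have hlap_cont : Continuous (lapE u) := continuous_finsetSum _ fun i _ =>
    (contDiff_partialDeriv (contDiff_partialDeriv hu i) i).continuous
  have hlap0 : ∀ x ∉ tsupport u, lapE u x = 0 := fun x hx => Finset.sum_eq_zero fun i _ =>
    partialDeriv_eq_zero (fun h => hx (tsupport_partialDeriv_subset i h)) i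
  have hquot : ContDiff ℝ (⊤ : ℕ∞) (fun x => u x ^ 2 / (1 - ‖x‖ ^ 2) ^ 4) := by
    refine contDiff_of_contDiffOn_ball (isClosed_tsupport u) hs
      (fun x hx => by simp [image_eq_zero_of_notMem_tsupport hx]) fun x hx => ?_
    exact (hu.contDiffAt.pow 2).div
      ((contDiffAt_const.sub (contDiff_norm_sq ℝ).contDiffAt).pow 4)
      (pow_ne_zero 4 (one_sub_norm_sq_pos hx).ne')
  have i1 : Integrable (fun x => |lapE u x| ^ 2) :=
    (hlap_cont.abs.pow 2).integrable_of_hasCompactSupport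
      (HasCompactSupport.intro hc fun x hx => by simp [hlap0 x hx])
  have i2 : Integrable (fun x => u x ^ 2 / (1 - ‖x‖ ^ 2) ^ 4) :=
    hquot.continuous.integrable_of_hasCompactSupport
      (HasCompactSupport.intro hc fun x hx => by simp [image_eq_zero_of_notMem_tsupport hx])
  have i3 : Integrable (fun x => u x ^ 2) :=
    (hu.continuous.pow 2).integrable_of_hasCompactSupport
      (HasCompactSupport.intro hc fun x hx => by simp [image_eq_zero_of_notMem_tsupport hx])
  have hF := fun i => contDiff_rellichField hu hs i
  have hFc : ∀ i, HasCompactSupport (rellichField u i) := fun i =>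
    HasCompactSupport.intro hc fun x hx => rellichField_eq_zero hx i
  have hF0 : ∀ x ∉ tsupport u, ∀ i, partialDeriv (rellichField u i) i x = 0 := fun x hx i =>
    partialDeriv_eq_zero (fun h => hx (closure_minimal
      (fun _ hy => by_contra fun hyu => Function.mem_support.1 hy (rellichField_eq_zero hyu i))
      (isClosed_tsupport u) h)) i
  have i4 : ∀ i, Integrable (partialDeriv (rellichField u i) i) := fun i =>
    (contDiff_partialDeriv (hF i) i).continuous.integrable_of_hasCompactSupport
      (HasCompactSupport.intro hc fun x hx => hF0 x hx i)
  have hdiv : ∫ x in Metric.ball (0 : E4) 1, ∑ i, partialDeriv (rellichField u i) i x = 0 := by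
    rw [setIntegral_eq_integral_of_forall_compl_eq_zero fun x hx =>
      Finset.sum_eq_zero fun i _ => hF0 x (fun h => hx (hs h)) i,
      integral_finsetSum _ fun i _ => i4 i]
    exact Finset.sum_eq_zero fun i _ => integral_partialDeriv_eq_zero (hF i) (hFc i) i
  have hpos := setIntegral_nonneg (μ := volume) Metric.isOpen_ball.measurableSet
    fun x hx => rellich_pointwise hu hs (x := x) hx
  have j12 : Integrable (fun x => |lapE u x| ^ 2 - 9 * (u x ^ 2 / (1 - ‖x‖ ^ 2) ^ 4)) :=
    i1.sub (i2.const_mul 9)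
  have j123 : Integrable (fun x => |lapE u x| ^ 2 - 9 * (u x ^ 2 / (1 - ‖x‖ ^ 2) ^ 4)
      - 30 * u x ^ 2) := j12.sub (i3.const_mul 30)
  rw [integral_add j123.integrableOn (integrable_finsetSum _ fun i _ => i4 i).integrableOn,
    integral_sub j12.integrableOn (i3.const_mul 30).integrableOn,
    integral_sub i1.integrableOn (i2.const_mul 9).integrableOn,
    integral_const_mul, integral_const_mul, hdiv] at hpos
  linarith
end

section
/- Let f ∈ C₀^∞(B⁴) and set u(x) = (1 − |x|²) f(x). Then ∫_{B⁴} |∇u(x)|²/(1 − |x|²)² dx = ∫_{B⁴} |∇f(x)|² dx + 8 ∫_{B⁴} f(x)²/(1 − |x|²)² dx. -/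
open MeasureTheory Real

section

variable {ι : Type*} [Fintype ι] [DecidableEq ι]

theorem integral_fderiv_apply_eq_zero {E : Type*} [NormedAddCommGroup E] [NormedSpace ℝ E]
    [FiniteDimensional ℝ E] [MeasurableSpace E] [BorelSpace E] (μ : Measure E) [μ.IsAddHaarMeasure]
    {g : E → ℝ} (hg : ContDiff ℝ 1 g) (hc : HasCompactSupport g) (v : E) :
    ∫ x, fderiv ℝ g x v ∂μ = 0 := by
  have hd : Integrable (fun x => fderiv ℝ g x v) μ :=
    ((hg.continuous_fderiv one_ne_zero).clm_apply continuous_const).integrable_of_hasCompactSupport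
      (hc.fderiv_apply ℝ v)
  have h := integral_mul_fderiv_eq_neg_fderiv_mul_of_integrable (μ := μ) (𝕜 := ℝ)
    (f := fun _ => (1 : ℝ)) (g := g) (v := v) (by simp) (by simpa using hd)
    (by simpa using hg.continuous.integrable_of_hasCompactSupport hc)
    (by fun_prop)
    fun x _ => hg.differentiable one_ne_zero x
  simpa using h

theorem hasFDerivAt_one_sub_norm_sq {E : Type*} [NormedAddCommGroup E] [InnerProductSpace ℝ E]
    (x : E) : HasFDerivAt (fun y : E => 1 - ‖y‖ ^ 2) (-(2 • innerSL ℝ x)) x :=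
  (hasStrictFDerivAt_norm_sq x).hasFDerivAt.const_sub 1

theorem fderiv_one_sub_norm_sq_mul_single {h : EuclideanSpace ℝ ι → ℝ} (hh : Differentiable ℝ h)
    (x : EuclideanSpace ℝ ι) (i : ι) :
    fderiv ℝ (fun y => (1 - ‖y‖ ^ 2) * h y) x (EuclideanSpace.single i 1)
      = (1 - ‖x‖ ^ 2) * fderiv ℝ h x (EuclideanSpace.single i 1) - 2 * x i * h x := by
  rw [((hasFDerivAt_one_sub_norm_sq x).fun_mul (hh x).hasFDerivAt).fderiv]
  simp [EuclideanSpace.inner_single_right]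
  ring

theorem fderiv_coord_mul_single {k : EuclideanSpace ℝ ι → ℝ} (hk : Differentiable ℝ k)
    (x : EuclideanSpace ℝ ι) (i : ι) :
    fderiv ℝ (fun y => y i * k y) x (EuclideanSpace.single i 1)
      = x i * fderiv ℝ k x (EuclideanSpace.single i 1) + k x := by
  have hp : HasFDerivAt (fun y : EuclideanSpace ℝ ι => y i)
      (EuclideanSpace.proj i : EuclideanSpace ℝ ι →L[ℝ] ℝ) x :=
    (EuclideanSpace.proj i : EuclideanSpace ℝ ι →L[ℝ] ℝ).hasFDerivAt
  rw [(hp.fun_mul (hk x).hasFDerivAt).fderiv]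
  simp

end

/-- Dividing by `1 - ‖x‖ ^ 2` preserves smoothness of functions supported in the open unit ball. -/
theorem contDiff_div_one_sub_norm_sq {E : Type*} [NormedAddCommGroup E] [InnerProductSpace ℝ E]
    {n : WithTop ℕ∞} {f : E → ℝ} (hf : ContDiff ℝ n f)
    (hs : tsupport f ⊆ Metric.ball (0 : E) 1) :
    ContDiff ℝ n fun x => f x / (1 - ‖x‖ ^ 2) := by
  rw [contDiff_iff_contDiffAt]
  intro x
  by_cases hx : x ∈ tsupport f
  · have hx1 : ‖x‖ < 1 := by simpa using hs hx
    refine hf.contDiffAt.div (contDiff_const.sub (contDiff_norm_sq ℝ)).contDiffAt ?_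
    nlinarith [norm_nonneg x]
  · refine (contDiffAt_const (c := (0 : ℝ))).congr_of_eventuallyEq ?_
    filter_upwards [notMem_tsupport_iff_eventuallyEq.mp hx] with y hy
    simp [hy]

theorem gradient_identity (f : EuclideanSpace ℝ (Fin 4) → ℝ)
    (hf : ContDiff ℝ (⊤ : ℕ∞) f) (hc : HasCompactSupport f)
    (hs : tsupport f ⊆ Metric.ball (0 : EuclideanSpace ℝ (Fin 4)) 1) :
    (∫ x in Metric.ball (0 : EuclideanSpace ℝ (Fin 4)) 1,
        (∑ i, (fderiv ℝ (fun y : EuclideanSpace ℝ (Fin 4) => (1 - ‖y‖ ^ 2) * f y) x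
          (EuclideanSpace.single i 1)) ^ 2) / (1 - ‖x‖ ^ 2) ^ 2)
      = (∫ x in Metric.ball (0 : EuclideanSpace ℝ (Fin 4)) 1,
          ∑ i, (fderiv ℝ f x (EuclideanSpace.single i 1)) ^ 2)
        + 8 * ∫ x in Metric.ball (0 : EuclideanSpace ℝ (Fin 4)) 1,
            f x ^ 2 / (1 - ‖x‖ ^ 2) ^ 2 := by
  set h : EuclideanSpace ℝ (Fin 4) → ℝ := fun x => f x / (1 - ‖x‖ ^ 2) with hh
  have hhf : ContDiff ℝ (⊤ : ℕ∞) h := contDiff_div_one_sub_norm_sq hf hs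
  have hf0 : ∀ x, x ∉ Metric.ball (0 : EuclideanSpace ℝ (Fin 4)) 1 → f x = 0 := fun x hx =>
    image_eq_zero_of_notMem_tsupport fun hx' => hx (hs hx')
  have hsupp : Function.support h ⊆ Function.support f := fun x hx hfx => hx (by
    simp [hh, hfx])
  have hhc : HasCompactSupport h := hc.mono hsupp
  have hw : ∀ x ∈ Metric.ball (0 : EuclideanSpace ℝ (Fin 4)) 1, 1 - ‖x‖ ^ 2 ≠ 0 := by
    intro x hx
    have : ‖x‖ < 1 := by simpa using hx
    nlinarith [norm_nonneg x]
  have hfh : f = fun x => (1 - ‖x‖ ^ 2) * h x := by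
    funext x
    by_cases hx : x ∈ Metric.ball (0 : EuclideanSpace ℝ (Fin 4)) 1
    · simp only [hh]
      field_simp [hw x hx]
    · simp [hh, hf0 x hx]
  have hfd : Differentiable ℝ f := hf.differentiable (by simp)
  have hhd : Differentiable ℝ h := hhf.differentiable (by simp)
  have hfhc : HasCompactSupport fun x => f x * h x := hc.mul_right
  let F : Fin 4 → EuclideanSpace ℝ (Fin 4) → ℝ := fun i x => x i * (f x * h x)
  have hF : ∀ i, ContDiff ℝ 1 (F i) := fun i => by
    have := hf.of_le (m := 1) (by simp)
    have := hhf.of_le (m := 1) (by simp)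
    fun_prop
  have hFc : ∀ i, HasCompactSupport (F i) := fun i => hfhc.mul_left
  let D : EuclideanSpace ℝ (Fin 4) → ℝ := fun x =>
    ∑ i, fderiv ℝ (F i) x (EuclideanSpace.single i 1)
  have hFi : ∀ i, Integrable fun x => fderiv ℝ (F i) x (EuclideanSpace.single i 1) := fun i =>
    (((hF i).continuous_fderiv one_ne_zero).clm_apply
      continuous_const).integrable_of_hasCompactSupport ((hFc i).fderiv_apply ℝ _)
  have hDi : Integrable D := integrable_finsetSum _ fun i _ => hFi i
  have hD0 : ∫ x in Metric.ball (0 : EuclideanSpace ℝ (Fin 4)) 1, D x = 0 := by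
    rw [setIntegral_eq_integral_of_forall_compl_eq_zero]
    · rw [integral_finsetSum _ fun i _ => hFi i]
      exact Finset.sum_eq_zero fun i _ => integral_fderiv_apply_eq_zero _ (hF i) (hFc i) _
    · intro x hx
      refine Finset.sum_eq_zero fun i _ => ?_
      have : F i =ᶠ[nhds x] fun _ => 0 := by
        filter_upwards [notMem_tsupport_iff_eventuallyEq.mp fun hx' => hx (hs hx')] with y hy
        simp [F, hy]
      simp [this.fderiv_eq]
  have hG : Integrable fun x => ∑ i, (fderiv ℝ f x (EuclideanSpace.single i 1)) ^ 2 := by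
    refine integrable_finsetSum _ fun i _ => ?_
    refine Continuous.integrable_of_hasCompactSupport
      (((hf.continuous_fderiv (by simp)).clm_apply continuous_const).pow 2) ?_
    exact (hc.fderiv_apply ℝ _).comp_left (g := fun t : ℝ => t ^ 2) (by simp)
  have hH : Integrable fun x => 8 * h x ^ 2 := by
    refine Continuous.integrable_of_hasCompactSupport
      (continuous_const.mul (hhf.continuous.pow 2)) ?_
    exact hhc.comp_left (g := fun t : ℝ => 8 * t ^ 2) (by simp)
  have hGH : Integrable fun x =>
      (∑ i, (fderiv ℝ f x (EuclideanSpace.single i 1)) ^ 2) + 8 * h x ^ 2 := hG.add hH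
  have hpt : ∀ x ∈ Metric.ball (0 : EuclideanSpace ℝ (Fin 4)) 1,
      (∑ i, (fderiv ℝ (fun y : EuclideanSpace ℝ (Fin 4) => (1 - ‖y‖ ^ 2) * f y) x
          (EuclideanSpace.single i 1)) ^ 2) / (1 - ‖x‖ ^ 2) ^ 2
        = (∑ i, (fderiv ℝ f x (EuclideanSpace.single i 1)) ^ 2) + 8 * h x ^ 2 - 2 * D x := by
    intro x hx
    have hn : ‖x‖ ^ 2 = ∑ i, x i ^ 2 := EuclideanSpace.real_norm_sq_eq x
    have hfx : f x = (1 - ‖x‖ ^ 2) * h x := congrFun hfh x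
    have hdf : ∀ i, fderiv ℝ f x (EuclideanSpace.single i 1)
        = (1 - ‖x‖ ^ 2) * fderiv ℝ h x (EuclideanSpace.single i 1) - 2 * x i * h x := fun i => by
      conv_lhs => rw [hfh]
      exact fderiv_one_sub_norm_sq_mul_single hhd x i
    have hdF : ∀ i, fderiv ℝ (F i) x (EuclideanSpace.single i 1)
        = x i * (f x * fderiv ℝ h x (EuclideanSpace.single i 1)
          + h x * fderiv ℝ f x (EuclideanSpace.single i 1)) + f x * h x := fun i => by
      rw [fderiv_coord_mul_single (k := fun y => f y * h y) (hfd.mul hhd),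
        fderiv_fun_mul (hfd x) (hhd x)]
      simp
    rw [div_eq_iff (pow_ne_zero 2 (hw x hx))]
    simp only [D, hdF, fderiv_one_sub_norm_sq_mul_single hfd, hdf, hfx]
    simp only [Fin.sum_univ_four] at hn ⊢
    rw [hn]
    ring
  have hfdiv : ∀ x, f x ^ 2 / (1 - ‖x‖ ^ 2) ^ 2 = h x ^ 2 := fun x => (div_pow _ _ 2).symm
  rw [setIntegral_congr_fun measurableSet_ball hpt,
    integral_sub hGH.integrableOn (hDi.const_mul 2).integrableOn,
    integral_add hG.integrableOn hH.integrableOn, integral_const_mul, integral_const_mul, hD0]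
  simp only [hfdiv, mul_zero, sub_zero]
end
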